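/- Let m be a positive integer, and let K(1) = Σ_{x ∈ GF(2^m)} (−1)^{Tr^m(x^{2^m−2} + x)} be the Kloosterman sum at 1. Then Σ_{x ∈ GF(2^m), Tr^m(x) = 0} (−1)^{Tr^m(x^{2^m−2})} = K(1)/2 and Σ_{x ∈ GF(2^m), Tr^m(x) = 1} (−1)^{Tr^m(x^{2^m−2})} = −K(1)/2. -/

import Mathlib

open Finset
noncomputable section
open scoped Classical

/-- `GF n` is the finite field with `2^n` elements. -/
abbrev GF (n : ℕ) : Type := GaloisField 2 n

noncomputable instance (n : ℕ) : Fintype (GF n) := Fintype.ofFinite _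

/-- The absolute trace map `GF n → 𝔽₂`. -/
def tr {n : ℕ} (x : GF n) : ZMod 2 := Algebra.trace (ZMod 2) (GF n) x

lemma neg_one_pow_val_add (a b : ZMod 2) :
    (-1 : ℤ) ^ (a + b).val = (-1) ^ a.val * (-1) ^ b.val := by
  revert a b
  decide

lemma tr_add {n : ℕ} (x y : GF n) : tr (x + y) = tr x + tr y := by
  simp [tr]

lemma sum_neg_one_pow_tr (n : ℕ) : ∑ x : GF n, (-1 : ℤ) ^ (tr x).val = 0 := by
  obtain ⟨a, ha⟩ := Algebra.trace_surjective (ZMod 2) (GF n) 1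
  have ha' : tr a = 1 := ha
  have h := Equiv.sum_comp (Equiv.addRight a) fun x : GF n => (-1 : ℤ) ^ (tr x).val
  simp only [Equiv.coe_addRight, tr_add, neg_one_pow_val_add, ha', ← Finset.sum_mul,
    ZMod.val_one, pow_one] at h
  linarith

lemma sum_neg_one_pow_tr_inv (n : ℕ) : ∑ x : GF n, (-1 : ℤ) ^ (tr x⁻¹).val = 0 :=
  (Equiv.sum_comp (Equiv.inv (GF n)) fun x => (-1 : ℤ) ^ (tr x).val).trans
    (sum_neg_one_pow_tr n)

lemma filter_tr_ne_zero (n : ℕ) :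
    univ.filter (fun x : GF n => ¬ tr x = 0) = univ.filter (fun x : GF n => tr x = 1) := by
  have h : ∀ z : ZMod 2, ¬ z = 0 ↔ z = 1 := by decide
  simp only [h]

lemma sum_eq_sum_filter_tr (n : ℕ) (f : GF n → ℤ) :
    ∑ x, f x = ∑ x ∈ univ.filter (fun x : GF n => tr x = 0), f x +
      ∑ x ∈ univ.filter (fun x : GF n => tr x = 1), f x := by
  rw [← Finset.sum_filter_add_sum_filter_not univ (fun x : GF n => tr x = 0) f,
    filter_tr_ne_zero]

/-- the Kloosterman sum `K(1)` splits into halves over the two cosets of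
the hyperplane `{x : Tr(x) = 0}`.  (Here `x⁻¹` is the inverse of `x` for `x ≠ 0` and
`0⁻¹ = 0`, i.e. `x ↦ x^(2^m-2)`.) -/
theorem stmt14 (m : ℕ) (hm : 1 ≤ m)
    (K1 : ℤ) (hK : K1 = ∑ x : GF m, (-1 : ℤ) ^ (tr (x⁻¹ + x)).val) :
    ((∑ x ∈ univ.filter (fun x : GF m => tr x = 0), (-1 : ℤ) ^ (tr x⁻¹).val : ℤ) : ℚ)
      = (K1 : ℚ) / 2 ∧
    ((∑ x ∈ univ.filter (fun x : GF m => tr x = 1), (-1 : ℤ) ^ (tr x⁻¹).val : ℤ) : ℚ)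
      = -((K1 : ℚ) / 2) := by
  set A := ∑ x ∈ univ.filter (fun x : GF m => tr x = 0), (-1 : ℤ) ^ (tr x⁻¹).val with hA
  set B := ∑ x ∈ univ.filter (fun x : GF m => tr x = 1), (-1 : ℤ) ^ (tr x⁻¹).val with hB
  have hsum : A + B = 0 :=
    (sum_eq_sum_filter_tr m _).symm.trans (sum_neg_one_pow_tr_inv m)
  have hdiff : K1 = A - B := by
    rw [hK, sum_eq_sum_filter_tr, hA, hB, sub_eq_add_neg, ← Finset.sum_neg_distrib]
    congr 1 <;> refine Finset.sum_congr rfl fun x hx => ?_ <;>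
      simp [tr_add, neg_one_pow_val_add, (Finset.mem_filter.mp hx).2, ZMod.val_one]
  have hBA : B = -A := by linarith
  rw [hdiff, hBA]
  push_cast
  constructor <;> ring
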